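/- For an integer N ≥ 4, let φ_k = (|0⟩ + e^{2πik/N}|1⟩)/√2 ∈ ℂ² for k = 0, …, N−1, and Λ = (1/N²)·Σ_{k=0}^{N−1} |φ_k⟩⟨φ_k| ⊗ |φ_k⟩⟨φ_k| − (1/N²)·Σ_{k≠j} |φ_k⟩⟨φ_k| ⊗ |φ_j⟩⟨φ_j|. Then Λ is negative semidefinite, and consequently the supremum over 4×4 matrices E with 0 ≤ E ≤ I of Re[ 1 − 1/N + tr(E·Λ) ] equals 1 − 1/N, attained at E = 0 (the 'no-measurement' strategy). -/

import Mathlib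

open Matrix Kronecker ComplexOrder

/-- The states `φ_k = (|0⟩ + e^{2πik/N}|1⟩)/√2`. -/
noncomputable def phaseState (N : ℕ) (k : Fin N) : Fin 2 → ℂ :=
  ![1 / Real.sqrt 2, Complex.exp (2 * Real.pi * Complex.I * k / N) / Real.sqrt 2]

/-- The comparison operator `Λ` of the `N` equiprobable phase states. -/
noncomputable def comparisonOp (N : ℕ) : Matrix (Fin 2 × Fin 2) (Fin 2 × Fin 2) ℂ :=
  (1 / (N : ℂ)^2) • ∑ k : Fin N,
      (Matrix.vecMulVec (phaseState N k) (star (phaseState N k))) ⊗ₖ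
        (Matrix.vecMulVec (phaseState N k) (star (phaseState N k)))
    - (1 / (N : ℂ)^2) • ∑ k : Fin N, ∑ j : Fin N, (if k = j then 0 else
      (Matrix.vecMulVec (phaseState N k) (star (phaseState N k))) ⊗ₖ
        (Matrix.vecMulVec (phaseState N j) (star (phaseState N j))))

/-- The root of unity `e^{2πi/N}` has unit modulus. -/
lemma exp_pow_mul_star (N k : ℕ) :
    Complex.exp (2 * Real.pi * Complex.I / N) ^ k *
      star (Complex.exp (2 * Real.pi * Complex.I / N) ^ k) = 1 := by
  rw [Complex.star_def, map_pow, ← mul_pow, ← Complex.exp_conj, ← Complex.exp_add]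
  simp [Complex.conj_ofReal, neg_div, map_ofNat]

/-- The projector `|φ_k⟩⟨φ_k|` has entries `1/2` on the diagonal and `e^{±2πik/N}/2` off it. -/
lemma vecMulVec_phaseState (N : ℕ) (k : Fin N) :
    vecMulVec (phaseState N k) (star (phaseState N k)) =
      !![1 / 2, star (Complex.exp (2 * Real.pi * Complex.I / N) ^ (k : ℕ)) / 2;
        Complex.exp (2 * Real.pi * Complex.I / N) ^ (k : ℕ) / 2, 1 / 2] := by
  have h2 : ((Real.sqrt 2 : ℝ) : ℂ) * ((Real.sqrt 2 : ℝ) : ℂ) = 2 := by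
    rw [← Complex.ofReal_mul, Real.mul_self_sqrt (by norm_num)]; norm_num
  have h0 : ((Real.sqrt 2 : ℝ) : ℂ) ≠ 0 := by
    intro h; rw [h] at h2; norm_num at h2
  have hz : Complex.exp (2 * Real.pi * Complex.I * k / N) =
      Complex.exp (2 * Real.pi * Complex.I / N) ^ (k : ℕ) := by
    rw [← Complex.exp_nat_mul]; congr 1; ring
  have hn : Complex.exp (2 * Real.pi * Complex.I / N) ^ (k : ℕ) *
      star (Complex.exp (2 * Real.pi * Complex.I / N) ^ (k : ℕ)) = 1 :=
    exp_pow_mul_star N k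
  simp only [phaseState, hz]
  generalize Complex.exp (2 * Real.pi * Complex.I / N) ^ (k : ℕ) = z at hn
  simp only [Complex.star_def] at hn
  ext i j
  fin_cases i <;> fin_cases j <;>
    simp [vecMulVec_apply, Complex.conj_ofReal, h2, ← mul_inv, div_eq_mul_inv]
  · field_simp
    linear_combination -(starRingEnd ℂ z) * h2
  · field_simp
    linear_combination -z * h2
  · field_simp
    linear_combination 2 * hn - h2

/-- The `m`-th powers of the `N`-th roots of unity sum to zero when `0 < m < N`. -/
lemma sum_exp_pow_eq_zero {N m : ℕ} (hm : 0 < m) (hmN : m < N) :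
    ∑ k : Fin N, (Complex.exp (2 * Real.pi * Complex.I / N) ^ (k : ℕ)) ^ m = 0 := by
  have hp := Complex.isPrimitiveRoot_exp N (by omega)
  set ζ := Complex.exp (2 * Real.pi * Complex.I / N)
  have h1 : ζ ^ m ≠ 1 := hp.pow_ne_one_of_pos_of_lt hm.ne' hmN
  have h : (ζ ^ m - 1) * ∑ k ∈ Finset.range N, (ζ ^ m) ^ k = 0 := by
    rw [mul_geom_sum, ← pow_mul, mul_comm, pow_mul, hp.pow_eq_one, one_pow, sub_self]
  have := (mul_eq_zero.mp h).resolve_left (sub_ne_zero.mpr h1)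
  rw [Finset.sum_range] at this
  simpa only [← pow_mul, mul_comm m] using this

/-- `-Λ` as a combination of the identity and three rank-one operators. -/
lemma neg_comparisonOp_eq {N : ℕ} (hN : 3 ≤ N) :
    -comparisonOp N = (1 / 4 - 1 / (N : ℂ)) • (1 : Matrix (Fin 2 × Fin 2) (Fin 2 × Fin 2) ℂ) +
      (1 / (2 * (N : ℂ))) •
        (vecMulVec (Pi.single (0, 0) 1) (star (Pi.single (0, 0) 1)) +
          vecMulVec (Pi.single (1, 1) 1) (star (Pi.single (1, 1) 1)) +
          vecMulVec (Pi.single (0, 1) 1 - Pi.single (1, 0) 1)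
            (star (Pi.single (0, 1) 1 - Pi.single (1, 0) 1))) := by
  have hN0 : (N : ℂ) ≠ 0 := by exact_mod_cast (by omega : N ≠ 0)
  set P : Fin N → Matrix (Fin 2) (Fin 2) ℂ :=
    fun k => vecMulVec (phaseState N k) (star (phaseState N k))
  have hs1 := sum_exp_pow_eq_zero (N := N) one_pos (by omega)
  have hs2 := sum_exp_pow_eq_zero (N := N) two_pos (by omega)
  have hc1 := congrArg star hs1
  have hc2 := congrArg star hs2
  have hn : ∀ k : Fin N, Complex.exp (2 * Real.pi * Complex.I / N) ^ (k : ℕ) *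
      star (Complex.exp (2 * Real.pi * Complex.I / N) ^ (k : ℕ)) = 1 :=
    fun k => exp_pow_mul_star N k
  have hPe := vecMulVec_phaseState N
  change ∀ k, P k = _ at hPe
  have hsplit : -comparisonOp N = (1 / (N : ℂ) ^ 2) •
      ((∑ k, P k) ⊗ₖ (∑ k, P k) - (2 : ℂ) • ∑ k, P k ⊗ₖ P k) := by
    have : ∀ k j : Fin N, (if k = j then 0 else P k ⊗ₖ P j) =
        P k ⊗ₖ P j - if k = j then P k ⊗ₖ P j else 0 := by
      intro k j; split_ifs <;> simp
    have hk : (∑ k, P k) ⊗ₖ (∑ k, P k) = ∑ k, ∑ j, P k ⊗ₖ P j := by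
      ext a b
      simp [Matrix.sum_apply, Finset.sum_mul_sum]
    have hc : comparisonOp N = (1 / (N : ℂ) ^ 2) • ∑ k, P k ⊗ₖ P k -
        (1 / (N : ℂ) ^ 2) • ∑ k, ∑ j, (if k = j then 0 else P k ⊗ₖ P j) := rfl
    simp only [hc, hk, this, Finset.sum_sub_distrib, Finset.sum_ite_eq,
      Finset.mem_univ, if_true]
    module
  rw [hsplit]
  generalize Complex.exp (2 * Real.pi * Complex.I / N) = ζ at *
  simp only [star_sum, star_pow, star_zero, pow_one] at *
  ext ⟨a, b⟩ ⟨c, d⟩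
  simp only [Matrix.smul_apply, Matrix.sub_apply, Matrix.add_apply, kroneckerMap_apply,
    Matrix.sum_apply, hPe, vecMulVec_apply]
  have e1 : ∀ k : Fin N, ζ ^ (k : ℕ) / 2 * (ζ ^ (k : ℕ) / 2) = (ζ ^ (k : ℕ)) ^ 2 / 4 := by
    intro k; ring
  have e2 : ∀ k : Fin N, star ζ ^ (k : ℕ) / 2 * (star ζ ^ (k : ℕ) / 2) = (star ζ ^ (k : ℕ)) ^ 2 / 4 := by
    intro k; ring
  have e3 : ∀ k : Fin N, ζ ^ (k : ℕ) / 2 * (star ζ ^ (k : ℕ) / 2) = 1 / 4 := by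
    intro k; linear_combination hn k / 4
  have e4 : ∀ k : Fin N, star ζ ^ (k : ℕ) / 2 * (ζ ^ (k : ℕ) / 2) = 1 / 4 := by
    intro k; linear_combination hn k / 4
  fin_cases a <;> fin_cases b <;> fin_cases c <;> fin_cases d <;>
    simp [-Complex.star_def, -RCLike.star_def, ← Finset.sum_div, ← Finset.mul_sum, ← Finset.sum_mul,
      e1, e2, e3, e4, hs1, hs2, hc1, hc2] <;>
    field_simp <;> ring

open scoped MatrixOrder in
/-- The trace of a product of two positive semidefinite matrices is nonnegative. -/
lemma Matrix.PosSemidef.trace_mul_nonneg {n : Type*} [Fintype n] [DecidableEq n]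
    {A B : Matrix n n ℂ} (hA : A.PosSemidef) (hB : B.PosSemidef) : 0 ≤ (A * B).trace := by
  obtain ⟨C, rfl⟩ := CStarAlgebra.nonneg_iff_eq_star_mul_self.mp hA.nonneg
  rw [Matrix.mul_assoc, Matrix.trace_mul_comm]
  exact (hB.mul_mul_conjTranspose_same C).trace_nonneg

/-- For `N ≥ 4`, the comparison operator is negative semidefinite. -/
lemma posSemidef_neg_comparisonOp {N : ℕ} (hN : 4 ≤ N) : (-comparisonOp N).PosSemidef := by
  have hNR : (4 : ℝ) ≤ N := by exact_mod_cast hN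
  have h1 : (0 : ℂ) ≤ 1 / 4 - 1 / (N : ℂ) := by
    have : (0 : ℝ) ≤ 1 / 4 - 1 / (N : ℝ) :=
      sub_nonneg.mpr (one_div_le_one_div_of_le (by norm_num) hNR)
    simpa using Complex.zero_le_real.mpr this
  have h2 : (0 : ℂ) ≤ 1 / (2 * (N : ℂ)) := by
    have : (0 : ℝ) ≤ 1 / (2 * (N : ℝ)) := by positivity
    simpa using Complex.zero_le_real.mpr this
  rw [neg_comparisonOp_eq (by omega)]
  exact (PosSemidef.one.smul h1).add
    ((((posSemidef_vecMulVec_self_star _).add (posSemidef_vecMulVec_self_star _)).add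
      (posSemidef_vecMulVec_self_star _)).smul h2)

/-- For `N ≥ 4` phase states, `Λ` is negative semidefinite and hence the optimal
comparison success probability `sup Re(1 - 1/N + tr(EΛ))` over `0 ≤ E ≤ I` equals
`1 - 1/N`, attained by the no-measurement strategy `E = 0`. -/
theorem no_measurement_optimal_for_N_ge_four (N : ℕ) (hN : 4 ≤ N) :
    (-(comparisonOp N)).PosSemidef ∧
    IsGreatest
      {x : ℝ | ∃ E : Matrix (Fin 2 × Fin 2) (Fin 2 × Fin 2) ℂ,
        E.PosSemidef ∧ (1 - E).PosSemidef ∧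
        x = ((1 : ℂ) - 1 / (N : ℂ) + (E * comparisonOp N).trace).re}
      (1 - 1 / (N : ℝ)) ∧
    ((0 : Matrix (Fin 2 × Fin 2) (Fin 2 × Fin 2) ℂ).PosSemidef ∧
     (1 - (0 : Matrix (Fin 2 × Fin 2) (Fin 2 × Fin 2) ℂ)).PosSemidef ∧
     ((1 : ℂ) - 1 / (N : ℂ) +
        ((0 : Matrix (Fin 2 × Fin 2) (Fin 2 × Fin 2) ℂ) * comparisonOp N).trace).re
       = 1 - 1 / (N : ℝ)) := by
  have hL := posSemidef_neg_comparisonOp hN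
  have h0 : ((1 : ℂ) - 1 / (N : ℂ) +
      ((0 : Matrix (Fin 2 × Fin 2) (Fin 2 × Fin 2) ℂ) * comparisonOp N).trace).re =
        1 - 1 / (N : ℝ) := by
    rw [Matrix.zero_mul, Matrix.trace_zero, add_zero]
    simp
  have hI : (1 - (0 : Matrix (Fin 2 × Fin 2) (Fin 2 × Fin 2) ℂ)).PosSemidef := by
    rw [sub_zero]; exact PosSemidef.one
  refine ⟨hL, ⟨⟨0, PosSemidef.zero, hI, h0.symm⟩, ?_⟩, PosSemidef.zero, hI, h0⟩
  rintro x ⟨E, hE, -, rfl⟩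
  have ht := (Complex.le_def.mp (hE.trace_mul_nonneg hL)).1
  rw [Matrix.mul_neg, Matrix.trace_neg, Complex.neg_re, Complex.zero_re] at ht
  rw [Matrix.zero_mul, Matrix.trace_zero, add_zero] at h0
  rw [Complex.add_re, h0]
  linarith
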